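/- arXiv:1612.05567 — 2 statements merged into one kernel-verified Lean document; each statement's English description precedes it below -/
import Mathlib

section
/- Let 𝐀 be a regular BBL transformation of bandwidth (p,q) on V_d^S, and let L ≤ R be finite integers with R − L ≥ τ. Then the bulk solution space on [L,R] is spanned by the projections of the two semi-infinite bulk solution spaces: M_{L,R} = Span(P_{L,R} M_{−∞,R} ∪ P_{L,R} M_{L,∞}). -/
noncomputable section

/-- The space of doubly-infinite sequences with values in `ℂ^d`. -/
abbrev SeqSp (d : ℕ) : Type := ℤ → Fin d → ℂ

/-- The shift `(Ψ_j)_j ↦ (Ψ_{j+n})_j`; for `n = 1` this is the left shift `T`. -/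
def shiftBy (d : ℕ) (n : ℤ) : Module.End ℂ (SeqSp d) where
  toFun Ψ := fun j => Ψ (j + n)
  map_add' _ _ := rfl
  map_smul' _ _ := rfl

/-- Entrywise multiplication of a sequence by a fixed `d × d` matrix. -/
def matOp (d : ℕ) (m : Matrix (Fin d) (Fin d) ℂ) : Module.End ℂ (SeqSp d) where
  toFun Ψ := fun j => m.mulVec (Ψ j)
  map_add' Ψ Φ := by funext j; simp [Matrix.mulVec_add]
  map_smul' c Ψ := by funext j; simp [Matrix.mulVec_smul]

/-- The banded block-Laurent (BBL) transformation `(𝐀Ψ)_j = ∑_{r=p}^{q} a_r ψ_{j+r}`. -/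
def bbl (d : ℕ) (a : ℤ → Matrix (Fin d) (Fin d) ℂ) (p q : ℤ) : Module.End ℂ (SeqSp d) :=
  ∑ r ∈ Finset.Icc p q, matOp d (a r) * shiftBy d r

/-- The projection `P_S` replacing every entry with index outside `S` by zero. -/
def projOn (d : ℕ) (S : Set ℤ) : Module.End ℂ (SeqSp d) where
  toFun Ψ := fun j => S.indicator Ψ j
  map_add' Ψ Φ := by
    funext j
    by_cases h : j ∈ S <;> simp [Set.indicator_apply, h]
  map_smul' c Ψ := by
    funext j
    by_cases h : j ∈ S <;> simp [Set.indicator_apply, h]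

/-- The window `{j : ℤ | Lb ≤ j ≤ Rb}`, with possibly infinite endpoints. -/
def windowSet (Lb : WithBot ℤ) (Rb : WithTop ℤ) : Set ℤ :=
  {j : ℤ | Lb ≤ (j : WithBot ℤ) ∧ (j : WithTop ℤ) ≤ Rb}

/-- Sequences supported in `S` (vanishing at every index outside `S`): the space `V_{L,R}`. -/
def suppIn (d : ℕ) (S : Set ℤ) : Submodule ℂ (SeqSp d) where
  carrier := {Ψ | ∀ j ∉ S, Ψ j = 0}
  add_mem' := by
    intro Ψ Φ hΨ hΦ j hj
    simp [Pi.add_apply, hΨ j hj, hΦ j hj]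
  zero_mem' := fun j _ => rfl
  smul_mem' := by
    intro c Ψ hΨ j hj
    simp [Pi.smul_apply, hΨ j hj]

/-- Sequences vanishing at every index of `S`. -/
def vanishOn (d : ℕ) (S : Set ℤ) : Submodule ℂ (SeqSp d) where
  carrier := {Ψ | ∀ j ∈ S, Ψ j = 0}
  add_mem' := by
    intro Ψ Φ hΨ hΦ j hj
    simp [Pi.add_apply, hΨ j hj, hΦ j hj]
  zero_mem' := fun j _ => rfl
  smul_mem' := by
    intro c Ψ hΨ j hj
    simp [Pi.smul_apply, hΨ j hj]

/-- The bulk solution space `M_{Lb,Rb} = Ker (P_{Lb−p',Rb−q'} 𝐀 |_{V_{Lb,Rb}})`, viewed as a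
submodule of the full sequence space: sequences supported in the window `[Lb,Rb]` whose image
under `𝐀` vanishes on the bulk window `[Lb−p', Rb−q']` (with `p' = min p 0`, `q' = max q 0`). -/
def bulkSol (d : ℕ) (a : ℤ → Matrix (Fin d) (Fin d) ℂ) (p q : ℤ)
    (Lb : WithBot ℤ) (Rb : WithTop ℤ) : Submodule ℂ (SeqSp d) :=
  suppIn d (windowSet Lb Rb) ⊓
    (vanishOn d (windowSet (Lb + ((-min p 0 : ℤ) : WithBot ℤ))
        (Rb + ((-max q 0 : ℤ) : WithTop ℤ)))).comap (bbl d a p q)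

/-- Falling-factorial type product `j^{(v)} = (j−v+1)(j−v+2)⋯j`. -/
def ff (j : ℤ) (v : ℕ) : ℤ := ∏ i ∈ Finset.range v, (j - i)

/-- The scalar sequence `Φ_{z,v}`, with `j`-th entry `j^{(v−1)} z^{j−v+1}`, and `Φ_{z,0} = 0`. -/
def Phi (z : ℂ) (v : ℕ) : ℤ → ℂ :=
  fun j => if v = 0 then 0 else (ff j (v - 1) : ℂ) * z ^ (j - (v : ℤ) + 1)

/-- The vector sequence `Φ_{z,v}|m⟩`. -/
def PhiVec (d : ℕ) (z : ℂ) (v : ℕ) (m : Fin d) : SeqSp d :=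
  fun j => Phi z v j • (Pi.single m 1 : Fin d → ℂ)

/-- The subspace `T_{z,s} = Span{Φ_{z,v}|m⟩ : 1 ≤ v ≤ s, 1 ≤ m ≤ d}`. -/
def Tspace (d : ℕ) (z : ℂ) (s : ℕ) : Submodule ℂ (SeqSp d) :=
  Submodule.span ℂ {Ψ : SeqSp d | ∃ v ∈ Finset.Icc 1 s, ∃ m : Fin d, Ψ = PhiVec d z v m}

/-- The symbol `A(w,w⁻¹) = ∑_{r=p}^q w^r a_r` as a matrix of Laurent polynomials. -/
def symbol (d : ℕ) (a : ℤ → Matrix (Fin d) (Fin d) ℂ) (p q : ℤ) :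
    Matrix (Fin d) (Fin d) (LaurentPolynomial ℂ) :=
  ∑ r ∈ Finset.Icc p q, (LaurentPolynomial.T r : LaurentPolynomial ℂ) • (a r).map (fun c => LaurentPolynomial.C c)

/-- The evaluation `A(z,z⁻¹) = ∑_{r=p}^q z^r a_r` of the symbol at `z ≠ 0`. -/
def symbolEval (d : ℕ) (a : ℤ → Matrix (Fin d) (Fin d) ℂ) (p q : ℤ) (z : ℂ) :
    Matrix (Fin d) (Fin d) ℂ :=
  ∑ r ∈ Finset.Icc p q, z ^ r • a r

/-- The `k`-th derivative `A^{(k)}(z,z⁻¹) = ∑_{r=p}^q r(r−1)⋯(r−k+1) z^{r−k} a_r`. -/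
def symbolDeriv (d : ℕ) (a : ℤ → Matrix (Fin d) (Fin d) ℂ) (p q : ℤ) (k : ℕ) (z : ℂ) :
    Matrix (Fin d) (Fin d) ℂ :=
  ∑ r ∈ Finset.Icc p q, ((ff r k : ℂ) * z ^ (r - (k : ℤ))) • a r

/-- The generalized kernel `⋃_k Ker (f^k)` of an endomorphism. -/
def genKer (d : ℕ) (f : Module.End ℂ (SeqSp d)) : Submodule ℂ (SeqSp d) :=
  ⨆ k : ℕ, LinearMap.ker (f ^ k)

/-- `F_L^− `: the generalized kernel of the unilateral shift `P_{L,∞}T` on `M_{L,∞}`. -/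
def Fminus (d : ℕ) (a : ℤ → Matrix (Fin d) (Fin d) ℂ) (p q : ℤ) (L : ℤ) :
    Submodule ℂ (SeqSp d) :=
  bulkSol d a p q (L : WithBot ℤ) ⊤ ⊓
    genKer d (projOn d (windowSet (L : WithBot ℤ) ⊤) * shiftBy d 1)

/-- `F_R^+`: the generalized kernel of the shift `P_{−∞,R}T⁻¹` on `M_{−∞,R}`. -/
def Fplus (d : ℕ) (a : ℤ → Matrix (Fin d) (Fin d) ℂ) (p q : ℤ) (R : ℤ) :
    Submodule ℂ (SeqSp d) :=
  bulkSol d a p q ⊥ (R : WithTop ℤ) ⊓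
    genKer d (projOn d (windowSet ⊥ (R : WithTop ℤ)) * shiftBy d (-1))

/-- The left shift on scalar sequences. -/
def shiftS : Module.End ℂ (ℤ → ℂ) where
  toFun φ := fun j => φ (j + 1)
  map_add' _ _ := rfl
  map_smul' _ _ := rfl

/-- The linear map on `SeqSp d` induced by a diagonal matrix polynomial with diagonal entries
`g m`: it acts on the `m`-th component of a sequence as `g m` evaluated at the left shift. -/
def diagPolyOp (d : ℕ) (g : Fin d → Polynomial ℂ) : Module.End ℂ (SeqSp d) where
  toFun Ψ := fun j m => Polynomial.aeval shiftS (g m) (fun i => Ψ i m) j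
  map_add' Ψ Φ := by
    funext j m
    show Polynomial.aeval shiftS (g m) ((fun i => Ψ i m) + (fun i => Φ i m)) j = _
    rw [map_add]
    rfl
  map_smul' c Ψ := by
    funext j m
    show Polynomial.aeval shiftS (g m) (c • (fun i => Ψ i m)) j = _
    rw [map_smul]
    rfl

/-- The subspace of sequences with values in `Span{|m⟩ : d₀ < m ≤ d}` (the range of `ρ_d(π)`). -/
def piRange (d d₀ : ℕ) : Submodule ℂ (SeqSp d) where
  carrier := {Ψ | ∀ j : ℤ, ∀ m : Fin d, (m : ℕ) < d₀ → Ψ j m = 0}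
  add_mem' := by
    intro Ψ Φ hΨ hΦ j m hm
    simp [Pi.add_apply, hΨ j m hm, hΦ j m hm]
  zero_mem' := fun j m _ => rfl
  smul_mem' := by
    intro c Ψ hΨ j m hm
    simp [Pi.smul_apply, hΨ j m hm]

/-- The Hilbert space `H` of square-summable half-infinite sequences, as a subspace of `SeqSp d`:
sequences vanishing at indices `j ≤ 0` whose restriction to `j ≥ 1` is in `ℓ²`. -/
def Hspace (d : ℕ) : Submodule ℂ (SeqSp d) where
  carrier := {Ψ | (∀ j : ℤ, j ≤ 0 → Ψ j = 0) ∧ Memℓp (fun n : ℕ => Ψ ((n : ℤ) + 1)) 2}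
  add_mem' := by
    intro Ψ Φ hΨ hΦ
    refine ⟨fun j hj => by simp [Pi.add_apply, hΨ.1 j hj, hΦ.1 j hj], ?_⟩
    exact hΨ.2.add hΦ.2
  zero_mem' := ⟨fun j _ => rfl, zero_memℓp⟩
  smul_mem' := by
    intro c Ψ hΨ
    exact ⟨fun j hj => by simp [Pi.smul_apply, hΨ.1 j hj], hΨ.2.const_smul c⟩


theorem bbl_apply (d : ℕ) (a : ℤ → Matrix (Fin d) (Fin d) ℂ) (p q : ℤ) (Ψ : SeqSp d) (j : ℤ) :
    bbl d a p q Ψ j = ∑ r ∈ Finset.Icc p q, (a r).mulVec (Ψ (j + r)) := by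
  simp [bbl, LinearMap.sum_apply, Finset.sum_apply, matOp, shiftBy]

theorem projOn_apply_of_mem {d : ℕ} {S : Set ℤ} {j : ℤ} (hj : j ∈ S) (Ψ : SeqSp d) :
    projOn d S Ψ j = Ψ j :=
  Set.indicator_of_mem hj Ψ

theorem projOn_apply_of_notMem {d : ℕ} {S : Set ℤ} {j : ℤ} (hj : j ∉ S) (Ψ : SeqSp d) :
    projOn d S Ψ j = 0 :=
  Set.indicator_of_notMem hj Ψ

theorem projOn_eq_self {d : ℕ} {S : Set ℤ} {Ψ : SeqSp d} (hΨ : Ψ ∈ suppIn d S) :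
    projOn d S Ψ = Ψ := by
  funext j
  by_cases hj : j ∈ S
  · exact projOn_apply_of_mem hj Ψ
  · rw [projOn_apply_of_notMem hj, hΨ j hj]

theorem projOn_projOn_of_subset {d : ℕ} {S S' : Set ℤ} (h : S ⊆ S') (Ψ : SeqSp d) :
    projOn d S (projOn d S' Ψ) = projOn d S Ψ := by
  funext j
  by_cases hj : j ∈ S
  · simp only [projOn_apply_of_mem hj, projOn_apply_of_mem (h hj)]
  · simp only [projOn_apply_of_notMem hj]

theorem add_mem_windowSet {p q j r : ℤ} {Lb : WithBot ℤ} {Rb : WithTop ℤ}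
    (hj : j ∈ windowSet (Lb + ((-min p 0 : ℤ) : WithBot ℤ)) (Rb + ((-max q 0 : ℤ) : WithTop ℤ)))
    (hr : r ∈ Finset.Icc p q) : j + r ∈ windowSet Lb Rb := by
  obtain ⟨hL, hR⟩ := hj
  rw [Finset.mem_Icc] at hr
  constructor
  · induction Lb using WithBot.recBotCoe with
    | bot => exact bot_le
    | coe L =>
      norm_cast at hL ⊢
      have := min_le_left p 0
      omega
  · induction Rb using WithTop.recTopCoe with
    | top => exact le_top
    | coe R =>
      norm_cast at hR ⊢
      have := le_max_left q 0
      omega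

/-- The bulk equations only involve entries inside the window. -/
theorem projOn_mem_bulkSol {d : ℕ} {a : ℤ → Matrix (Fin d) (Fin d) ℂ} {p q : ℤ}
    {Lb : WithBot ℤ} {Rb : WithTop ℤ} {Ψ : SeqSp d}
    (hΨ : ∀ j ∈ windowSet (Lb + ((-min p 0 : ℤ) : WithBot ℤ))
      (Rb + ((-max q 0 : ℤ) : WithTop ℤ)), bbl d a p q Ψ j = 0) :
    projOn d (windowSet Lb Rb) Ψ ∈ bulkSol d a p q Lb Rb := by
  refine ⟨fun j hj => projOn_apply_of_notMem hj Ψ, fun j hj => ?_⟩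
  rw [← hΨ j hj, bbl_apply, bbl_apply]
  exact Finset.sum_congr rfl fun r hr => by rw [projOn_apply_of_mem (add_mem_windowSet hj hr)]

theorem symbol_apply (d : ℕ) (a : ℤ → Matrix (Fin d) (Fin d) ℂ) (p q : ℤ) (m n : Fin d) :
    symbol d a p q m n
      = ∑ r ∈ Finset.Icc p q, LaurentPolynomial.T r * LaurentPolynomial.C (a r m n) := by
  simp [symbol, Matrix.sum_apply]

/-- A regular BBL transformation is surjective: it is the transpose of the injective map
`h ↦ h A` on row vectors of Laurent polynomials. -/
theorem bbl_surjective {d : ℕ} {a : ℤ → Matrix (Fin d) (Fin d) ℂ} {p q : ℤ}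
    (hreg : (symbol d a p q).det ≠ 0) : Function.Surjective (bbl d a p q) := by
  intro φ
  let N : (Fin d → LaurentPolynomial ℂ) →ₗ[ℂ] (Fin d → LaurentPolynomial ℂ) :=
    (symbol d a p q).vecMulLinear.restrictScalars ℂ
  have hN : Function.Injective N := by
    refine (injective_iff_map_eq_zero N).2 fun h hh => ?_
    exact Matrix.eq_zero_of_vecMul_eq_zero hreg hh
  let F : Module.Dual ℂ (Fin d → LaurentPolynomial ℂ) :=
    ∑ m : Fin d, ((AddMonoidAlgebra.basis ℤ ℂ).constr ℂ fun i => φ i m) ∘ₗ LinearMap.proj m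
  have hF : ∀ (j : ℤ) (m : Fin d), F (Pi.single m (LaurentPolynomial.T j)) = φ j m := by
    intro j m
    have hT : (AddMonoidAlgebra.basis ℤ ℂ).constr ℂ (fun i => φ i m)
        (LaurentPolynomial.T j) = φ j m := by
      rw [LaurentPolynomial.T, ← AddMonoidAlgebra.basis_apply, Module.Basis.constr_basis]
    rw [LinearMap.sum_apply, Finset.sum_eq_single m _ (by simp)]
    · simpa using hT
    · intro n _ hn
      simp [hn]
  obtain ⟨G, hG⟩ := LinearMap.dualMap_surjective_of_injective hN F
  refine ⟨fun j m => G (Pi.single m (LaurentPolynomial.T j)), ?_⟩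
  funext j m
  rw [← hF, ← hG, LinearMap.dualMap_apply, bbl_apply]
  have hrow : N (Pi.single m (LaurentPolynomial.T j))
      = ∑ r ∈ Finset.Icc p q, ∑ n : Fin d,
          a r m n • (Pi.single n (LaurentPolynomial.T (j + r)) : Fin d → LaurentPolynomial ℂ) := by
    funext k
    simp only [N, LinearMap.restrictScalars_apply, Matrix.vecMulLinear_apply,
      Matrix.single_vecMul, Finset.sum_apply, Pi.smul_apply, Matrix.row_apply, symbol_apply,
      smul_eq_mul, Finset.mul_sum]
    refine Finset.sum_congr rfl fun r _ => ?_
    rw [Finset.sum_eq_single k (fun n _ hn => by simp [hn.symm]) (by simp), Pi.single_eq_same,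
      LaurentPolynomial.smul_eq_C_mul, LaurentPolynomial.T_add]
    ring
  rw [hrow]
  simp [Matrix.mulVec, dotProduct, map_sum]

theorem stmt_12 (d : ℕ) (hd : 1 ≤ d) (p q : ℤ) (hpq : p ≤ q)
    (a : ℤ → Matrix (Fin d) (Fin d) ℂ) (hap : a p ≠ 0) (haq : a q ≠ 0)
    (hreg : (symbol d a p q).det ≠ 0)
    (L R : ℤ) (hLR : max q 0 - min p 0 ≤ R - L) :
    bulkSol d a p q (L : WithBot ℤ) (R : WithTop ℤ)
      = (bulkSol d a p q ⊥ (R : WithTop ℤ)).map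
            (projOn d (windowSet (L : WithBot ℤ) (R : WithTop ℤ)))
          ⊔ (bulkSol d a p q (L : WithBot ℤ) ⊤).map
            (projOn d (windowSet (L : WithBot ℤ) (R : WithTop ℤ))) := by
  apply le_antisymm
  · rintro Ψ ⟨hsupp, hbulk⟩
    obtain ⟨U, hU⟩ := bbl_surjective hreg (projOn d (Set.Ioi (R - max q 0)) (bbl d a p q Ψ))
    rw [← projOn_eq_self hsupp, ← add_sub_cancel U Ψ, map_add]
    refine Submodule.add_mem_sup ⟨projOn d (windowSet ⊥ R) U, projOn_mem_bulkSol ?_, ?_⟩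
      ⟨projOn d (windowSet L ⊤) (Ψ - U), projOn_mem_bulkSol ?_, ?_⟩
    · rintro j ⟨-, hj⟩
      norm_cast at hj
      rw [hU, projOn_apply_of_notMem]
      rw [Set.mem_Ioi]
      omega
    · exact projOn_projOn_of_subset (fun _ ⟨_, hj⟩ => ⟨bot_le, hj⟩ : windowSet L R ⊆ windowSet ⊥ R) U
    · rintro j ⟨hj, -⟩
      rw [map_sub, Pi.sub_apply, hU]
      by_cases hjR : j ∈ Set.Ioi (R - max q 0)
      · rw [projOn_apply_of_mem hjR, sub_self]
      · rw [projOn_apply_of_notMem hjR, sub_zero]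
        refine hbulk j ⟨hj, ?_⟩
        rw [Set.mem_Ioi] at hjR
        norm_cast
        omega
    · exact projOn_projOn_of_subset (fun _ ⟨hj, _⟩ => ⟨hj, le_top⟩ : windowSet L R ⊆ windowSet L ⊤) _
  · refine sup_le ?_ ?_
    · rintro _ ⟨Ψ, ⟨-, hΨ⟩, rfl⟩
      exact projOn_mem_bulkSol fun j hj => hΨ j ⟨bot_le, hj.2⟩
    · rintro _ ⟨Ψ, ⟨-, hΨ⟩, rfl⟩
      exact projOn_mem_bulkSol fun j hj => hΨ j ⟨hj.1, le_top⟩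

end
end

section
/- Let 𝐀 be a regular BBL transformation of bandwidth (p,q) on V_d^S with σ = dτ − dim Ker 𝐀, let L ≤ R be finite with N = R − L + 1 ≥ τ + 2σ, and define the square operators K⁻ = P_{L−p', L+σ−1−p'} 𝐀 |_{V_{L, L+σ−1}} and K⁺ = P_{R−σ+1−q', R−q'} 𝐀 |_{V_{R−σ+1, R}}. Then F_L^− = Ker K⁻ and F_R^+ = Ker K⁺, where F_L^− and F_R^+ are the generalized kernels of the unilateral shifts P_{L,∞}T on M_{L,∞} and P_{−∞,R}T⁻¹ on M_{−∞,R}, respectively. -/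
noncomputable section

/-- Summation over `[p, q]` rewritten as a sum over the enlarged window starting at `min p 0`. -/
theorem sum_Icc_eq_sum_range_window {M : Type*} [AddCommMonoid M] (p q : ℤ) (τ : ℕ)
    (hτ : (τ : ℤ) = max q 0 - min p 0) (g : ℤ → M) :
    ∑ r ∈ Finset.Icc p q, g r = ∑ s ∈ Finset.range (τ + 1),
      if min p 0 + (s : ℤ) ∈ Finset.Icc p q then g (min p 0 + s) else 0 := by
  rw [← Finset.sum_filter]
  refine Finset.sum_nbij' (fun r => (r - min p 0).toNat) (fun s => min p 0 + (s : ℤ)) ?_ ?_ ?_ ?_ ?_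
  · intro r hr
    simp only [Finset.mem_Icc, Finset.mem_filter, Finset.mem_range] at hr ⊢
    omega
  · intro s hs
    exact (Finset.mem_filter.1 hs).2
  · intro r hr
    simp only [Finset.mem_Icc] at hr
    omega
  · intro s _
    omega
  · intro r hr
    simp only [Finset.mem_Icc] at hr
    congr 1
    omega

section Recurrence

open Polynomial

variable {ι : Type*} [AddMonoidWithOne ι]

/-- The left shift on scalar sequences indexed by `ι`. -/
def seqShift (ι : Type*) [AddMonoidWithOne ι] : Module.End ℂ (ι → ℂ) where
  toFun y := fun j => y (j + 1)
  map_add' _ _ := rfl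
  map_smul' _ _ := rfl

theorem seqShift_pow_apply (k : ℕ) (y : ι → ℂ) (j : ι) :
    (seqShift ι ^ k) y j = y (j + k) := by
  induction k generalizing j with
  | zero => simp
  | succ k ih =>
    rw [pow_succ', Module.End.mul_apply]
    show (seqShift ι ^ k) y (j + 1) = _
    rw [ih, add_assoc, Nat.cast_succ, ← Nat.cast_one, ← Nat.cast_add, ← Nat.cast_add, add_comm 1 k]

theorem aeval_seqShift_apply (P : ℂ[X]) (y : ι → ℂ) (j : ι) :
    aeval (seqShift ι) P y j = ∑ k ∈ Finset.range (P.natDegree + 1), P.coeff k * y (j + k) := by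
  rw [aeval_eq_sum_range]
  simp [LinearMap.sum_apply, Finset.sum_apply, seqShift_pow_apply]

theorem aeval_seqShift_surjective {P : ℂ[X]} (hP : P ≠ 0) :
    Function.Surjective (aeval (seqShift ℕ) P) := by
  have hlin : ∀ c : ℂ, Function.Surjective (aeval (seqShift ℕ) (X - C c)) := by
    intro c t
    let y : ℕ → ℂ := fun n => Nat.rec 0 (fun n y => c * y + t n) n
    have hy : ∀ n, y (n + 1) = c * y n + t n := fun n => rfl
    refine ⟨y, ?_⟩
    funext n
    simp [seqShift, Module.algebraMap_end_apply, hy]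
  have hprod : ∀ s : Multiset ℂ,
      Function.Surjective (aeval (seqShift ℕ) (s.map fun c => X - C c).prod) := by
    intro s
    induction s using Multiset.induction_on with
    | empty =>
      rw [Multiset.map_zero, Multiset.prod_zero, map_one]
      exact Function.surjective_id
    | cons c s ih =>
      rw [Multiset.map_cons, Multiset.prod_cons, map_mul]
      exact (hlin c).comp ih
  have h := (IsAlgClosed.splits P).eq_prod_roots
  intro t
  obtain ⟨y, hy⟩ := hprod P.roots t
  refine ⟨P.leadingCoeff⁻¹ • y, ?_⟩
  calc aeval (seqShift ℕ) P (P.leadingCoeff⁻¹ • y)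
      = aeval (seqShift ℕ) (C P.leadingCoeff * (P.roots.map fun c => X - C c).prod)
          (P.leadingCoeff⁻¹ • y) := by rw [← h]
    _ = P.leadingCoeff • P.leadingCoeff⁻¹ • t := by
      rw [map_mul, Module.End.mul_apply, map_smul, hy, aeval_C, Module.algebraMap_end_apply]
    _ = t := smul_inv_smul₀ (leadingCoeff_ne_zero.2 hP) t

theorem eq_zero_of_aeval_seqShift_nat {P : ℂ[X]} (hP : P ≠ 0) {y : ℕ → ℂ}
    (h : aeval (seqShift ℕ) P y = 0) (h0 : ∀ n < P.natDegree, y n = 0) : y = 0 := by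
  funext n
  induction n using Nat.strong_induction_on with
  | _ n ih =>
    by_cases hn : n < P.natDegree
    · exact h0 n hn
    have h1 := congrFun h (n - P.natDegree)
    rw [aeval_seqShift_apply, Finset.sum_range_succ, Finset.sum_eq_zero, zero_add] at h1
    · have h2 : n - P.natDegree + P.natDegree = n := by omega
      simpa [h2, hP] using h1
    · intro k hk
      rw [Finset.mem_range] at hk
      have := ih (n - P.natDegree + k) (by omega)
      simp_all

theorem eq_zero_of_aeval_seqShift_int {P : ℂ[X]} (hP : P ≠ 0) {y : ℤ → ℂ}
    (h : aeval (seqShift ℤ) P y = 0) {N : ℤ} (h0 : ∀ n ≥ N, y n = 0) : y = 0 := by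
  have key : ∀ k : ℕ, ∀ n ≥ N - k, y n = 0 := by
    intro k
    induction k with
    | zero => simpa using h0
    | succ k ih =>
      intro n hn
      by_cases hnk : n ≥ N - k
      · exact ih n hnk
      have h1 := congrFun h (n - P.natTrailingDegree)
      rw [aeval_seqShift_apply, Finset.sum_eq_single P.natTrailingDegree] at h1
      · simpa [hP] using h1
      · intro l _ hl
        rcases lt_or_gt_of_ne hl with hl | hl
        · rw [coeff_eq_zero_of_lt_natTrailingDegree hl, zero_mul]
        · rw [ih _ (by push_cast at hn; omega), mul_zero]
      · intro hmem
        exact absurd (Finset.mem_range.2 (Nat.lt_succ_of_le P.natTrailingDegree_le_natDegree)) hmem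
  funext n
  exact key (N - n).toNat n (by omega)

/-- The action of a polynomial matrix on tuples of vectors, the indeterminate acting as `f`. -/
def matPolyAct {d : ℕ} {E : Type*} [AddCommGroup E] [Module ℂ E] (f : Module.End ℂ E)
    (B : Matrix (Fin d) (Fin d) ℂ[X]) (x : Fin d → E) : Fin d → E :=
  fun i => ∑ k, aeval f (B i k) (x k)

theorem matPolyAct_mul {d : ℕ} {E : Type*} [AddCommGroup E] [Module ℂ E] (f : Module.End ℂ E)
    (B C : Matrix (Fin d) (Fin d) ℂ[X]) (x : Fin d → E) :
    matPolyAct f (B * C) x = matPolyAct f B (matPolyAct f C x) := by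
  funext i
  simp only [matPolyAct, Matrix.mul_apply, map_sum, LinearMap.sum_apply, map_mul,
    Module.End.mul_apply]
  exact Finset.sum_comm

theorem matPolyAct_smul_one {d : ℕ} {E : Type*} [AddCommGroup E] [Module ℂ E]
    (f : Module.End ℂ E) (P : ℂ[X]) (x : Fin d → E) :
    matPolyAct f (P • (1 : Matrix (Fin d) (Fin d) ℂ[X])) x = fun i => aeval f P (x i) := by
  funext i
  simp only [matPolyAct, Matrix.smul_apply, smul_eq_mul]
  rw [Finset.sum_eq_single i]
  · simp
  · intro k _ hk
    simp [Matrix.one_apply_ne hk.symm]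
  · simp

/-- The matrix polynomial `∑_{r ≤ τ} X^r b_r`. -/
def matPoly {d : ℕ} (b : ℕ → Matrix (Fin d) (Fin d) ℂ) (τ : ℕ) :
    Matrix (Fin d) (Fin d) ℂ[X] :=
  ∑ r ∈ Finset.range (τ + 1), (X ^ r : ℂ[X]) • (b r).map C

/-- The operator `(x_j)_j ↦ (∑_{r ≤ τ} b_r x_{j+r})_j`. -/
def recOp {d : ℕ} (ι : Type*) [AddMonoidWithOne ι] (b : ℕ → Matrix (Fin d) (Fin d) ℂ) (τ : ℕ) :
    Module.End ℂ (ι → Fin d → ℂ) where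
  toFun x := fun j => ∑ r ∈ Finset.range (τ + 1), (b r).mulVec (x (j + r))
  map_add' x y := by
    funext j
    simp [Matrix.mulVec_add, Finset.sum_add_distrib]
  map_smul' c x := by
    funext j
    simp [Matrix.mulVec_smul, Finset.smul_sum]

theorem recOp_apply {d : ℕ} (b : ℕ → Matrix (Fin d) (Fin d) ℂ) (τ : ℕ) (x : ι → Fin d → ℂ)
    (j : ι) : recOp ι b τ x j = ∑ r ∈ Finset.range (τ + 1), (b r).mulVec (x (j + r)) := rfl

theorem recOp_eq_matPolyAct {d : ℕ} (b : ℕ → Matrix (Fin d) (Fin d) ℂ) (τ : ℕ)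
    (x : ι → Fin d → ℂ) :
    Function.swap (recOp ι b τ x) = matPolyAct (seqShift ι) (matPoly b τ) (Function.swap x) := by
  funext i j
  simp only [Function.swap, recOp_apply, Finset.sum_apply, Matrix.mulVec, dotProduct, matPolyAct,
    matPoly, Matrix.sum_apply, Matrix.smul_apply, Matrix.map_apply, smul_eq_mul, map_sum, map_mul,
    map_pow, aeval_X, aeval_C, LinearMap.sum_apply, Module.End.mul_apply,
    Module.algebraMap_end_apply, map_smul, Pi.smul_apply, seqShift_pow_apply]
  exact Finset.sum_comm

theorem aeval_det_eq_zero_of_recOp_eq_zero {d : ℕ} {b : ℕ → Matrix (Fin d) (Fin d) ℂ} {τ : ℕ}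
    {x : ι → Fin d → ℂ} (hx : recOp ι b τ x = 0) (m : Fin d) :
    aeval (seqShift ι) (matPoly b τ).det (fun j => x j m) = 0 := by
  have h := matPolyAct_mul (seqShift ι) (matPoly b τ).adjugate (matPoly b τ) (Function.swap x)
  rw [Matrix.adjugate_mul, matPolyAct_smul_one, ← recOp_eq_matPolyAct, hx] at h
  refine (congrFun h m).trans ?_
  exact Finset.sum_eq_zero fun k _ => map_zero _

theorem recOp_nat_surjective {d : ℕ} {b : ℕ → Matrix (Fin d) (Fin d) ℂ} {τ : ℕ}
    (hb : (matPoly b τ).det ≠ 0) : Function.Surjective (recOp ℕ b τ) := by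
  intro t
  choose y hy using fun i => aeval_seqShift_surjective hb (fun j => t j i)
  refine ⟨Function.swap (matPolyAct (seqShift ℕ) (matPoly b τ).adjugate y), ?_⟩
  apply Function.swap_bijective.injective
  rw [recOp_eq_matPolyAct]
  show matPolyAct _ _ (matPolyAct _ _ y) = _
  rw [← matPolyAct_mul, Matrix.mul_adjugate, matPolyAct_smul_one]
  funext i
  exact hy i

/-- The truncation of `recOp` to finite windows. -/
def recOpWindow {d : ℕ} (b : ℕ → Matrix (Fin d) (Fin d) ℂ) (τ n : ℕ) :
    (Fin (n + τ) → Fin d → ℂ) →ₗ[ℂ] (Fin n → Fin d → ℂ) where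
  toFun x := fun j => ∑ r : Fin (τ + 1), (b r).mulVec (x ⟨j + r, by omega⟩)
  map_add' x y := by
    funext j
    simp [Matrix.mulVec_add, Finset.sum_add_distrib]
  map_smul' c x := by
    funext j
    simp [Matrix.mulVec_smul, Finset.smul_sum]

theorem recOpWindow_restrict {d : ℕ} (b : ℕ → Matrix (Fin d) (Fin d) ℂ) (τ n : ℕ)
    (x : ℕ → Fin d → ℂ) :
    recOpWindow b τ n (fun j => x j) = fun j : Fin n => recOp ℕ b τ x j := by
  funext j
  rw [recOp_apply, Finset.sum_range]
  rfl

theorem finrank_ker_recOpWindow {d : ℕ} {b : ℕ → Matrix (Fin d) (Fin d) ℂ} {τ : ℕ}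
    (hb : (matPoly b τ).det ≠ 0) (n : ℕ) :
    Module.finrank ℂ (LinearMap.ker (recOpWindow b τ n)) = d * τ := by
  have hsurj : Function.Surjective (recOpWindow b τ n) := by
    intro t
    obtain ⟨x, hx⟩ := recOp_nat_surjective hb (fun j => if h : j < n then t ⟨j, h⟩ else 0)
    refine ⟨fun j => x j, ?_⟩
    rw [recOpWindow_restrict, hx]
    funext j
    simp
  have h := LinearMap.finrank_range_add_finrank_ker (recOpWindow b τ n)
  rw [LinearMap.range_eq_top.2 hsurj, finrank_top] at h
  simp only [Module.finrank_pi_fintype, Module.finrank_self, Finset.sum_const, Finset.card_univ,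
    Fintype.card_fin, smul_eq_mul, mul_one] at h
  nlinarith

theorem exists_injective_ker_recOp_nat {d : ℕ} {b : ℕ → Matrix (Fin d) (Fin d) ℂ} {τ : ℕ}
    (hb : (matPoly b τ).det ≠ 0) :
    ∃ g : LinearMap.ker (recOp ℕ b τ) →ₗ[ℂ]
      LinearMap.ker (recOpWindow b τ (matPoly b τ).det.natDegree), Function.Injective g := by
  let res := (LinearMap.funLeft ℂ (Fin d → ℂ)
    (fun j : Fin ((matPoly b τ).det.natDegree + τ) => (j : ℕ)))
  refine ⟨res.restrict (p := LinearMap.ker (recOp ℕ b τ)) ?_, ?_⟩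
  · intro x hx
    rw [LinearMap.mem_ker] at hx ⊢
    refine (recOpWindow_restrict b τ _ x).trans ?_
    rw [hx]
    rfl
  · rw [← LinearMap.ker_eq_bot, LinearMap.ker_eq_bot']
    rintro ⟨x, hx⟩ h
    have h' : ∀ j : Fin ((matPoly b τ).det.natDegree + τ), x j = 0 :=
      fun j => congrFun (congrArg Subtype.val h) j
    apply Subtype.ext
    funext j m
    refine congrFun (eq_zero_of_aeval_seqShift_nat hb
      (aeval_det_eq_zero_of_recOp_eq_zero (LinearMap.mem_ker.1 hx) m) ?_) j
    intro n hn
    exact congrFun (h' ⟨n, by omega⟩) m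

theorem eq_zero_of_recOp_int {d : ℕ} {b : ℕ → Matrix (Fin d) (Fin d) ℂ} {τ : ℕ}
    (hb : (matPoly b τ).det ≠ 0) {x : ℤ → Fin d → ℂ} (hx : recOp ℤ b τ x = 0) {N : ℤ}
    (h0 : ∀ n ≥ N, x n = 0) : x = 0 := by
  funext j m
  exact congrFun (eq_zero_of_aeval_seqShift_int hb (aeval_det_eq_zero_of_recOp_eq_zero hx m)
    (fun n hn => congrFun (h0 n hn) m)) j

/-- The eventually vanishing one-sided solutions of the recurrence given by `b`. -/
def finSol {d : ℕ} (b : ℕ → Matrix (Fin d) (Fin d) ℂ) (τ : ℕ) :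
    Submodule ℂ (ℕ → Fin d → ℂ) where
  carrier := {x | recOp ℕ b τ x = 0 ∧ ∃ N, ∀ n ≥ N, x n = 0}
  add_mem' := by
    rintro x y ⟨hx, N, hN⟩ ⟨hy, M, hM⟩
    refine ⟨by rw [map_add, hx, hy, add_zero], max N M, fun n hn => ?_⟩
    rw [Pi.add_apply, hN n (le_trans (le_max_left _ _) hn), hM n (le_trans (le_max_right _ _) hn),
      add_zero]
  zero_mem' := ⟨map_zero _, 0, fun _ _ => rfl⟩
  smul_mem' := by
    rintro c x ⟨hx, N, hN⟩
    refine ⟨by rw [map_smul, hx, smul_zero], N, fun n hn => ?_⟩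
    rw [Pi.smul_apply, hN n hn, smul_zero]

theorem finite_and_finrank_finSol_add_le {d : ℕ} {b : ℕ → Matrix (Fin d) (Fin d) ℂ} {τ : ℕ}
    (hb : (matPoly b τ).det ≠ 0) :
    Module.Finite ℂ (finSol b τ) ∧
    Module.finrank ℂ (LinearMap.ker (recOp ℤ b τ)) + Module.finrank ℂ (finSol b τ) ≤ d * τ := by
  obtain ⟨g, hg⟩ := exists_injective_ker_recOp_nat hb
  let res : LinearMap.ker (recOp ℤ b τ) →ₗ[ℂ] LinearMap.ker (recOp ℕ b τ) :=
    (LinearMap.funLeft ℂ (Fin d → ℂ) (fun n : ℕ => (n : ℤ))).restrict fun x hx => by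
      rw [LinearMap.mem_ker] at hx ⊢
      funext n
      have := congrFun hx n
      simpa [recOp_apply, LinearMap.funLeft_apply] using this
  let inc : finSol b τ →ₗ[ℂ] LinearMap.ker (recOp ℕ b τ) :=
    Submodule.inclusion fun x hx => LinearMap.mem_ker.2 hx.1
  have hinj : Function.Injective (g ∘ₗ res.coprod inc) := by
    refine hg.comp ?_
    rw [← LinearMap.ker_eq_bot, LinearMap.ker_eq_bot']
    rintro ⟨⟨x, hx⟩, ⟨y, hy⟩⟩ h
    have h' : ∀ n : ℕ, x n + y n = 0 := fun n => congrFun (congrArg Subtype.val h) n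
    obtain ⟨N, hN⟩ := hy.2
    have hx0 : x = 0 := by
      refine eq_zero_of_recOp_int hb (LinearMap.mem_ker.1 hx) (N := N) fun n hn => ?_
      lift n to ℕ using by omega
      have := h' n
      rwa [hN n (by omega), add_zero] at this
    have hy0 : y = 0 := by
      funext n
      have := h' n
      rwa [hx0, Pi.zero_apply, zero_add] at this
    subst hx0 hy0
    rfl
  have hfin := Module.Finite.of_injective _ hinj
  have h1 : Module.Finite ℂ (LinearMap.ker (recOp ℤ b τ)) :=
    Module.Finite.of_surjective (LinearMap.fst ℂ _ (finSol b τ)) LinearMap.fst_surjective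
  have h2 : Module.Finite ℂ (finSol b τ) :=
    Module.Finite.of_surjective (LinearMap.snd ℂ (LinearMap.ker (recOp ℤ b τ)) _)
      LinearMap.snd_surjective
  refine ⟨h2, ?_⟩
  rw [← Module.finrank_prod, ← finrank_ker_recOpWindow hb (matPoly b τ).det.natDegree]
  exact LinearMap.finrank_le_finrank_of_injective hinj

theorem eq_zero_of_mem_finSol {d : ℕ} {b : ℕ → Matrix (Fin d) (Fin d) ℂ} {τ : ℕ}
    (hb : (matPoly b τ).det ≠ 0) {x : ℕ → Fin d → ℂ} (hx : x ∈ finSol b τ) {n : ℕ}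
    (hn : d * τ ≤ n + Module.finrank ℂ (LinearMap.ker (recOp ℤ b τ))) : x n = 0 := by
  obtain ⟨hfin, hle⟩ := finite_and_finrank_finSol_add_le hb
  let S : Module.End ℂ (finSol b τ) :=
    (LinearMap.funLeft ℂ (Fin d → ℂ) (fun n : ℕ => n + 1)).restrict fun y hy => by
      obtain ⟨h0, N, hN⟩ := hy
      refine ⟨?_, N, fun n hn => hN (n + 1) (by omega)⟩
      funext j
      have := congrFun h0 (j + 1)
      simpa [recOp_apply, LinearMap.funLeft_apply, add_right_comm] using this
  have hS : ∀ (k : ℕ) (y : finSol b τ) (j : ℕ), ((S ^ k) y).1 j = y.1 (j + k) := by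
    intro k
    induction k with
    | zero => intro y j; rfl
    | succ k ih =>
      intro y j
      rw [pow_succ, Module.End.mul_apply, ih]
      rfl
  obtain ⟨N, hN⟩ := hx.2
  have h1 : (⟨x, hx⟩ : finSol b τ) ∈ LinearMap.ker (S ^ N) := by
    rw [LinearMap.mem_ker]
    apply Subtype.ext
    funext j
    rw [hS]
    exact hN _ (by omega)
  have h2 := Module.End.ker_pow_le_ker_pow_finrank S N h1
  have h3 := hS (Module.finrank ℂ (finSol b τ)) ⟨x, hx⟩ (n - Module.finrank ℂ (finSol b τ))
  rw [LinearMap.mem_ker.1 h2, Nat.sub_add_cancel (by omega)] at h3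
  exact h3.symm

end Recurrence

section Reversal

open Polynomial

theorem eval_det_matPoly {d : ℕ} (b : ℕ → Matrix (Fin d) (Fin d) ℂ) (τ : ℕ) (z : ℂ) :
    (matPoly b τ).det.eval z = (∑ r ∈ Finset.range (τ + 1), z ^ r • b r).det := by
  rw [← coe_evalRingHom, RingHom.map_det]
  congr 1
  ext i j
  simp [matPoly, Matrix.sum_apply]
  exact Finset.sum_congr rfl fun _ _ => mul_comm _ _

theorem det_matPoly_reverse_ne_zero {d : ℕ} {b : ℕ → Matrix (Fin d) (Fin d) ℂ} {τ : ℕ}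
    (hb : (matPoly b τ).det ≠ 0) : (matPoly (fun s => b (τ - s)) τ).det ≠ 0 := by
  intro h0
  apply mul_ne_zero hb (X_ne_zero (R := ℂ))
  refine Polynomial.funext fun z => ?_
  rw [eval_mul, eval_X, eval_zero]
  by_cases hz : z = 0
  · rw [hz, mul_zero]
  have h1 := eval_det_matPoly (fun s => b (τ - s)) τ z⁻¹
  have h2 : ∑ r ∈ Finset.range (τ + 1), z ^ r • b r
      = z ^ τ • ∑ r ∈ Finset.range (τ + 1), z⁻¹ ^ r • b (τ - r) := by
    rw [← Finset.sum_range_reflect, Finset.smul_sum]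
    refine Finset.sum_congr rfl fun r hr => ?_
    have hr' : r ≤ τ := Nat.lt_succ_iff.1 (Finset.mem_range.1 hr)
    rw [smul_smul, show τ + 1 - 1 - r = τ - r by omega, pow_sub₀ z hz hr', inv_pow]
  rw [h0, eval_zero] at h1
  rw [eval_det_matPoly, h2, Matrix.det_smul, ← h1, mul_zero, zero_mul]

end Reversal

/-- The coefficients of `w ^ (-min p 0) * A(w, w⁻¹)`. -/
def windowCoeff {d : ℕ} (a : ℤ → Matrix (Fin d) (Fin d) ℂ) (p q : ℤ) (s : ℕ) :
    Matrix (Fin d) (Fin d) ℂ :=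
  if min p 0 + (s : ℤ) ∈ Finset.Icc p q then a (min p 0 + s) else 0

theorem bbl_apply_eq_recOp {d : ℕ} (a : ℤ → Matrix (Fin d) (Fin d) ℂ) {p q : ℤ} {τ : ℕ}
    (hτ : (τ : ℤ) = max q 0 - min p 0) (Ψ : SeqSp d) (j : ℤ) :
    bbl d a p q Ψ j = recOp ℤ (windowCoeff a p q) τ Ψ (j + min p 0) := by
  have h : bbl d a p q Ψ j = ∑ r ∈ Finset.Icc p q, (a r).mulVec (Ψ (j + r)) := by
    simp [bbl, LinearMap.sum_apply, Finset.sum_apply, matOp, shiftBy]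
  rw [h, sum_Icc_eq_sum_range_window p q τ hτ, recOp_apply]
  refine Finset.sum_congr rfl fun s _ => ?_
  rw [windowCoeff]
  split_ifs
  · rw [add_assoc]
  · simp

theorem finrank_ker_bbl {d : ℕ} (a : ℤ → Matrix (Fin d) (Fin d) ℂ) {p q : ℤ} {τ : ℕ}
    (hτ : (τ : ℤ) = max q 0 - min p 0) :
    Module.finrank ℂ (LinearMap.ker (bbl d a p q))
      = Module.finrank ℂ (LinearMap.ker (recOp ℤ (windowCoeff a p q) τ)) := by
  have h : LinearMap.ker (bbl d a p q) = LinearMap.ker (recOp ℤ (windowCoeff a p q) τ) := by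
    ext Ψ
    rw [LinearMap.mem_ker, LinearMap.mem_ker]
    constructor <;> intro h <;> funext j
    · have := bbl_apply_eq_recOp a hτ Ψ (j - min p 0)
      rw [h, sub_add_cancel] at this
      exact this.symm
    · rw [bbl_apply_eq_recOp a hτ, h]
      rfl
  rw [h]

theorem finrank_ker_recOp_reverse {d : ℕ} (b : ℕ → Matrix (Fin d) (Fin d) ℂ) (τ : ℕ) :
    Module.finrank ℂ (LinearMap.ker (recOp ℤ (fun s => b (τ - s)) τ))
      = Module.finrank ℂ (LinearMap.ker (recOp ℤ b τ)) := by
  have key : ∀ (x : ℤ → Fin d → ℂ) (j : ℤ),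
      recOp ℤ (fun s => b (τ - s)) τ (fun j => x (-j)) j = recOp ℤ b τ x (-j - τ) := by
    intro x j
    rw [recOp_apply, recOp_apply, ← Finset.sum_range_reflect]
    refine Finset.sum_congr rfl fun r hr => ?_
    have hr' : r ≤ τ := Nat.lt_succ_iff.1 (Finset.mem_range.1 hr)
    rw [show τ + 1 - 1 - r = τ - r by omega, Nat.sub_sub_self hr', Nat.cast_sub hr']
    congr 2
    ring
  have hker : LinearMap.ker (recOp ℤ b τ) = (LinearMap.ker (recOp ℤ (fun s => b (τ - s)) τ)).comap
      (LinearEquiv.funCongrLeft ℂ (Fin d → ℂ) (Equiv.neg ℤ)).toLinearMap := by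
    ext x
    rw [Submodule.mem_comap, LinearMap.mem_ker, LinearMap.mem_ker]
    constructor <;> intro h <;> funext j
    · exact (key x j).trans (congrFun h _)
    · have := key x (-j - τ)
      rw [show -(-j - (τ : ℤ)) - τ = j by ring] at this
      exact this.symm.trans (congrFun h _)
  rw [hker]
  exact (LinearEquiv.ofSubmodule' _ _).finrank_eq.symm

theorem det_matPoly_windowCoeff_ne_zero {d : ℕ} {a : ℤ → Matrix (Fin d) (Fin d) ℂ} {p q : ℤ}
    {τ : ℕ} (hτ : (τ : ℤ) = max q 0 - min p 0) (hreg : (symbol d a p q).det ≠ 0) :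
    (matPoly (windowCoeff a p q) τ).det ≠ 0 := by
  have h : symbol d a p q = (LaurentPolynomial.T (min p 0) : LaurentPolynomial ℂ) •
      (Polynomial.toLaurent (R := ℂ)).mapMatrix (matPoly (windowCoeff a p q) τ) := by
    rw [symbol, sum_Icc_eq_sum_range_window p q τ hτ, matPoly, map_sum, Finset.smul_sum]
    refine Finset.sum_congr rfl fun s _ => ?_
    rw [windowCoeff]
    split_ifs
    · ext1 i j
      simp only [Matrix.smul_apply, Matrix.map_apply, smul_eq_mul, RingHom.mapMatrix_apply,
        map_mul, Polynomial.toLaurent_X_pow, Polynomial.toLaurent_C, LaurentPolynomial.T_add,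
        mul_assoc]
    · ext1 i j
      simp
  intro h0
  apply hreg
  rw [h, Matrix.det_smul, ← RingHom.map_det, h0, map_zero, mul_zero]

theorem mem_genKer_projOn_mul_shiftBy {d : ℕ} {S : Set ℤ} {n : ℤ} (hS : ∀ j ∈ S, j + n ∈ S)
    (Ψ : SeqSp d) :
    Ψ ∈ genKer d (projOn d S * shiftBy d n) ↔ ∃ N : ℕ, ∀ j ∈ S, Ψ (j + N * n) = 0 := by
  have hpow : ∀ (k : ℕ), ∀ j ∈ S,
      ((projOn d S * shiftBy d n) ^ k) Ψ j = Ψ (j + k * n) := by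
    intro k
    induction k with
    | zero => simp
    | succ k ih =>
      intro j hj
      rw [pow_succ', Module.End.mul_apply]
      refine (Set.indicator_of_mem hj _).trans ((ih _ (hS j hj)).trans ?_)
      congr 1
      push_cast
      ring
  refine (Submodule.mem_iSup_of_chain
    (LinearMap.iterateKer (projOn d S * shiftBy d n)) Ψ).trans ?_
  constructor
  · rintro ⟨k, hk⟩
    refine ⟨k, fun j hj => ?_⟩
    rw [← hpow k j hj]
    exact congrFun (LinearMap.mem_ker.1 hk) j
  · rintro ⟨N, hN⟩
    refine ⟨N + 1, LinearMap.mem_ker.2 ?_⟩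
    funext j
    by_cases hj : j ∈ S
    · rw [hpow _ j hj]
      have := hN (j + n) (hS j hj)
      rw [show j + ((N + 1 : ℕ) : ℤ) * n = j + n + N * n by push_cast; ring, this]
      rfl
    · rw [pow_succ', Module.End.mul_apply]
      exact Set.indicator_of_notMem hj _

theorem bbl_apply_eq_zero {d : ℕ} (a : ℤ → Matrix (Fin d) (Fin d) ℂ) {p q : ℤ} {Ψ : SeqSp d}
    {j : ℤ} (h : ∀ r ∈ Finset.Icc p q, Ψ (j + r) = 0) : bbl d a p q Ψ j = 0 := by
  simp only [bbl, LinearMap.sum_apply, Finset.sum_apply]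
  refine Finset.sum_eq_zero fun r hr => ?_
  show (a r).mulVec (Ψ (j + r)) = 0
  rw [h r hr, Matrix.mulVec_zero]

theorem eq_zero_of_bbl_eq_zero_right {d : ℕ} {a : ℤ → Matrix (Fin d) (Fin d) ℂ} {p q σ : ℤ}
    (hreg : (symbol d a p q).det ≠ 0)
    (hσ : σ = d * (max q 0 - min p 0) - Module.finrank ℂ ↥(LinearMap.ker (bbl d a p q)))
    {L N : ℤ} {Ψ : SeqSp d} (hΨ : ∀ j, L - min p 0 ≤ j → bbl d a p q Ψ j = 0)
    (hN : ∀ j, N ≤ j → Ψ j = 0) {j : ℤ} (hL : L ≤ j) (hj : L + σ ≤ j) : Ψ j = 0 := by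
  obtain ⟨τ, hτ⟩ : ∃ τ : ℕ, (τ : ℤ) = max q 0 - min p 0 :=
    ⟨(max q 0 - min p 0).toNat, by omega⟩
  have hb := det_matPoly_windowCoeff_ne_zero hτ hreg
  have hx : (fun n : ℕ => Ψ (L + n)) ∈ finSol (windowCoeff a p q) τ := by
    refine ⟨?_, (N - L).toNat, fun n hn => hN _ (by omega)⟩
    funext n
    have h := hΨ (L + n - min p 0) (by omega)
    rw [bbl_apply_eq_recOp a hτ, sub_add_cancel, recOp_apply] at h
    simpa [recOp_apply, add_assoc] using h
  rw [finrank_ker_bbl a hτ, ← hτ] at hσ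
  have h := eq_zero_of_mem_finSol hb hx (n := (j - L).toNat) (by zify; omega)
  rwa [show L + ((j - L).toNat : ℤ) = j by omega] at h

theorem eq_zero_of_bbl_eq_zero_left {d : ℕ} {a : ℤ → Matrix (Fin d) (Fin d) ℂ} {p q σ : ℤ}
    (hreg : (symbol d a p q).det ≠ 0)
    (hσ : σ = d * (max q 0 - min p 0) - Module.finrank ℂ ↥(LinearMap.ker (bbl d a p q)))
    {R N : ℤ} {Ψ : SeqSp d} (hΨ : ∀ j, j ≤ R - max q 0 → bbl d a p q Ψ j = 0)
    (hN : ∀ j, j ≤ N → Ψ j = 0) {j : ℤ} (hR : j ≤ R) (hj : j ≤ R - σ) : Ψ j = 0 := by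
  obtain ⟨τ, hτ⟩ : ∃ τ : ℕ, (τ : ℤ) = max q 0 - min p 0 :=
    ⟨(max q 0 - min p 0).toNat, by omega⟩
  have hb := det_matPoly_reverse_ne_zero (det_matPoly_windowCoeff_ne_zero hτ hreg)
  have hx : (fun n : ℕ => Ψ (R - n)) ∈ finSol (fun s => windowCoeff a p q (τ - s)) τ := by
    refine ⟨?_, (R - N).toNat, fun n hn => hN _ (by omega)⟩
    funext n
    have h := hΨ (R - n - max q 0) (by omega)
    rw [bbl_apply_eq_recOp a hτ, recOp_apply, ← Finset.sum_range_reflect] at h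
    rw [recOp_apply, Pi.zero_apply, ← h]
    refine Finset.sum_congr rfl fun r hr => ?_
    have hr' : r ≤ τ := Nat.lt_succ_iff.1 (Finset.mem_range.1 hr)
    rw [show τ + 1 - 1 - r = τ - r by omega, Nat.cast_sub hr']
    congr 2
    push_cast
    omega
  rw [finrank_ker_bbl a hτ, ← hτ, ← finrank_ker_recOp_reverse] at hσ
  have h := eq_zero_of_mem_finSol hb hx (n := (R - j).toNat) (by zify; omega)
  rwa [show R - ((R - j).toNat : ℤ) = j by omega] at h

theorem stmt_14 (d : ℕ) (hd : 1 ≤ d) (p q : ℤ) (hpq : p ≤ q)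
    (a : ℤ → Matrix (Fin d) (Fin d) ℂ) (hap : a p ≠ 0) (haq : a q ≠ 0)
    (hreg : (symbol d a p q).det ≠ 0)
    (σ : ℤ) (hσ : σ = d * (max q 0 - min p 0)
        - Module.finrank ℂ ↥(LinearMap.ker (bbl d a p q)))
    (L R : ℤ) (hN : (max q 0 - min p 0) + 2 * σ ≤ R - L + 1) :
    Fminus d a p q L
        = suppIn d (windowSet (L : WithBot ℤ) ((L + σ - 1 : ℤ) : WithTop ℤ)) ⊓
            (vanishOn d (windowSet ((L - min p 0 : ℤ) : WithBot ℤ)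
                ((L + σ - 1 - min p 0 : ℤ) : WithTop ℤ))).comap (bbl d a p q) ∧
    Fplus d a p q R
        = suppIn d (windowSet ((R - σ + 1 : ℤ) : WithBot ℤ) ((R : ℤ) : WithTop ℤ)) ⊓
            (vanishOn d (windowSet ((R - σ + 1 - max q 0 : ℤ) : WithBot ℤ)
                ((R - max q 0 : ℤ) : WithTop ℤ))).comap (bbl d a p q) := by
  have hWr : ∀ l j : ℤ, j ∈ windowSet (l : WithBot ℤ) ⊤ ↔ l ≤ j := fun l j => by
    simp [windowSet]
  have hWl : ∀ r j : ℤ, j ∈ windowSet ⊥ (r : WithTop ℤ) ↔ j ≤ r := fun r j => by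
    simp [windowSet]
  have hW : ∀ l r j : ℤ, j ∈ windowSet (l : WithBot ℤ) (r : WithTop ℤ) ↔ l ≤ j ∧ j ≤ r :=
    fun l r j => by simp [windowSet]
  constructor
  · ext Ψ
    rw [Fminus, Submodule.mem_inf, mem_genKer_projOn_mul_shiftBy
      (fun j hj => (hWr L _).2 (by have := (hWr L j).1 hj; omega)), bulkSol, Submodule.mem_inf,
      Submodule.mem_inf, top_add, ← WithBot.coe_add]
    constructor
    · rintro ⟨⟨hs, hv⟩, N, hN⟩
      have hv' : ∀ j, L - min p 0 ≤ j → bbl d a p q Ψ j = 0 :=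
        fun j hj => hv j ((hWr _ j).2 (by omega))
      refine ⟨fun j hj => ?_, fun j hj => hv' j ((hW _ _ j).1 hj).1⟩
      rw [hW] at hj
      by_cases hL : L ≤ j
      · refine eq_zero_of_bbl_eq_zero_right hreg hσ hv' (N := L + N) (fun i hi => ?_) hL (by omega)
        have := hN (i - N) ((hWr _ _).2 (by omega))
        rwa [mul_one, sub_add_cancel] at this
      · exact hs j (mt (hWr L j).1 hL)
    · rintro ⟨hs, hv⟩
      have hs' : ∀ j, L + σ - 1 < j → Ψ j = 0 := fun j hj => hs j (by rw [hW]; omega)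
      refine ⟨⟨fun j hj => hs j ?_, fun j hj => ?_⟩, σ.toNat, fun j hj => hs' _ ?_⟩
      · rw [hWr] at hj
        rw [hW]
        omega
      · rw [hWr] at hj
        by_cases h : j ≤ L + σ - 1 - min p 0
        · exact hv j ((hW _ _ j).2 ⟨by omega, h⟩)
        · refine bbl_apply_eq_zero a fun r hr => hs' _ ?_
          rw [Finset.mem_Icc] at hr
          omega
      · rw [hWr] at hj
        omega
  · ext Ψ
    rw [Fplus, Submodule.mem_inf, mem_genKer_projOn_mul_shiftBy
      (fun j hj => (hWl R _).2 (by have := (hWl R j).1 hj; omega)), bulkSol, Submodule.mem_inf,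
      Submodule.mem_inf, WithBot.bot_add, ← WithTop.coe_add]
    constructor
    · rintro ⟨⟨hs, hv⟩, N, hN⟩
      have hv' : ∀ j, j ≤ R - max q 0 → bbl d a p q Ψ j = 0 :=
        fun j hj => hv j ((hWl _ j).2 (by omega))
      refine ⟨fun j hj => ?_, fun j hj => hv' j ((hW _ _ j).1 hj).2⟩
      rw [hW] at hj
      by_cases hR : j ≤ R
      · refine eq_zero_of_bbl_eq_zero_left hreg hσ hv' (N := R - N) (fun i hi => ?_) hR (by omega)
        have := hN (i + N) ((hWl _ _).2 (by omega))
        rwa [mul_neg_one, add_neg_cancel_right] at this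
      · exact hs j (mt (hWl R j).1 hR)
    · rintro ⟨hs, hv⟩
      have hs' : ∀ j, j < R - σ + 1 → Ψ j = 0 := fun j hj => hs j (by rw [hW]; omega)
      refine ⟨⟨fun j hj => hs j ?_, fun j hj => ?_⟩, σ.toNat, fun j hj => hs' _ ?_⟩
      · rw [hWl] at hj
        rw [hW]
        omega
      · rw [hWl] at hj
        by_cases h : R - σ + 1 - max q 0 ≤ j
        · exact hv j ((hW _ _ j).2 ⟨h, by omega⟩)
        · refine bbl_apply_eq_zero a fun r hr => hs' _ ?_
          rw [Finset.mem_Icc] at hr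
          omega
      · rw [hWl] at hj
        omega

end
end
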